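/- Let ⟦f,g⟧ := g·f′ − g′·f denote the bracket on smooth functions f, g : ℝ → ℝ. The smallest real linear subspace of the space of smooth functions ℝ → ℝ that contains the five functions t ↦ 1, t ↦ cos t, t ↦ sin t, t ↦ cos 2t, t ↦ sin 2t and is closed under the bracket ⟦·,·⟧ is exactly the space of all real trigonometric polynomials. In particular, for every integer n ≥ 1 the functions t ↦ cos(n t) and t ↦ sin(n t) lie in the Lie subalgebra generated by these five functions. -/

import Mathlib

/-- The bracket `⟦f,g⟧ = g·f′ − g′·f` on smooth functions `f g : ℝ → ℝ`. -/
noncomputable def vbracket (f g : ℝ → ℝ) : ℝ → ℝ :=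
  fun t => g t * deriv f t - deriv g t * f t

/-- The generating set of the space of real trigonometric polynomials:
the constant function `1` and the functions `t ↦ cos (n t)`, `t ↦ sin (n t)`
for integers `n ≥ 1`. -/
def trigPolyGens : Set (ℝ → ℝ) :=
  {fun _ => (1 : ℝ)} ∪
    {f | ∃ n : ℕ, 1 ≤ n ∧
        (f = (fun t => Real.cos (n * t)) ∨ f = (fun t => Real.sin (n * t)))}

/-- The five functions `1, cos t, sin t, cos 2t, sin 2t`. -/
def fiveGens : Set (ℝ → ℝ) :=
  {fun _ => (1 : ℝ), fun t => Real.cos t, fun t => Real.sin t,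
    fun t => Real.cos (2 * t), fun t => Real.sin (2 * t)}

/-- The smallest real linear subspace of `ℝ → ℝ` containing the five functions
`1, cos t, sin t, cos 2t, sin 2t` and closed under the bracket `⟦·,·⟧`. -/
noncomputable def generatedLieAlg : Submodule ℝ (ℝ → ℝ) :=
  sInf {S : Submodule ℝ (ℝ → ℝ) |
    fiveGens ⊆ (S : Set (ℝ → ℝ)) ∧ ∀ f ∈ S, ∀ g ∈ S, vbracket f g ∈ S}

open Real in
theorem vbracket_cos_cos (a b : ℝ) :
    vbracket (fun t => cos (a * t)) (fun t => cos (b * t)) =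
      ((b - a) / 2) • (fun t => sin ((a + b) * t)) -
        ((a + b) / 2) • (fun t => sin ((a - b) * t)) := by
  ext t
  simp only [vbracket, deriv_comp_mul_left, Real.deriv_cos, Pi.sub_apply, Pi.smul_apply,
    smul_eq_mul, add_mul, sub_mul, sin_add, sin_sub]
  ring

open Real in
theorem vbracket_sin_sin (a b : ℝ) :
    vbracket (fun t => sin (a * t)) (fun t => sin (b * t)) =
      ((a - b) / 2) • (fun t => sin ((a + b) * t)) -
        ((a + b) / 2) • (fun t => sin ((a - b) * t)) := by
  ext t
  simp only [vbracket, deriv_comp_mul_left, Real.deriv_sin, Pi.sub_apply, Pi.smul_apply,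
    smul_eq_mul, add_mul, sub_mul, sin_add, sin_sub]
  ring

open Real in
theorem vbracket_sin_cos (a b : ℝ) :
    vbracket (fun t => sin (a * t)) (fun t => cos (b * t)) =
      ((a - b) / 2) • (fun t => cos ((a + b) * t)) +
        ((a + b) / 2) • (fun t => cos ((a - b) * t)) := by
  ext t
  simp only [vbracket, deriv_comp_mul_left, Real.deriv_sin, Real.deriv_cos, Pi.add_apply,
    Pi.smul_apply, smul_eq_mul, add_mul, sub_mul, cos_add, cos_sub]
  ring

theorem vbracket_antisymm (f g : ℝ → ℝ) : vbracket f g = -vbracket g f := by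
  ext t
  simp only [vbracket, Pi.neg_apply]
  ring

theorem vbracket_add_left {f₁ f₂ : ℝ → ℝ} (h₁ : Differentiable ℝ f₁) (h₂ : Differentiable ℝ f₂)
    (g : ℝ → ℝ) : vbracket (f₁ + f₂) g = vbracket f₁ g + vbracket f₂ g := by
  ext t
  simp only [vbracket, Pi.add_apply, deriv_add (h₁ t) (h₂ t)]
  ring

theorem vbracket_smul_left (c : ℝ) (f g : ℝ → ℝ) : vbracket (c • f) g = c • vbracket f g := by
  ext t
  simp only [vbracket, Pi.smul_apply, smul_eq_mul, deriv_const_smul_field]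
  ring

/-- The span of a set of differentiable functions is closed under the bracket as soon as it
contains the brackets of elements of that set. -/
theorem vbracket_mem_span {s : Set (ℝ → ℝ)} (hd : ∀ f ∈ s, Differentiable ℝ f)
    (hs : ∀ f ∈ s, ∀ g ∈ s, vbracket f g ∈ Submodule.span ℝ s) {f g : ℝ → ℝ}
    (hf : f ∈ Submodule.span ℝ s) (hg : g ∈ Submodule.span ℝ s) :
    vbracket f g ∈ Submodule.span ℝ s := by
  have hdiff : ∀ f ∈ Submodule.span ℝ s, Differentiable ℝ f := fun f hf => by
    induction hf using Submodule.span_induction with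
    | mem f hf => exact hd f hf
    | zero => exact differentiable_const 0
    | add f₁ f₂ _ _ h₁ h₂ => exact h₁.add h₂
    | smul c f _ h => exact h.const_smul c
  have hleft : ∀ g, (∀ f ∈ s, vbracket f g ∈ Submodule.span ℝ s) →
      ∀ f ∈ Submodule.span ℝ s, vbracket f g ∈ Submodule.span ℝ s := fun g hg f hf => by
    induction hf using Submodule.span_induction with
    | mem f hf => exact hg f hf
    | zero =>
      rw [← zero_smul ℝ g, vbracket_smul_left, zero_smul]
      exact Submodule.zero_mem _
    | add f₁ f₂ m₁ m₂ h₁ h₂ =>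
      rw [vbracket_add_left (hdiff _ m₁) (hdiff _ m₂)]
      exact Submodule.add_mem _ h₁ h₂
    | smul c f _ h =>
      rw [vbracket_smul_left]
      exact Submodule.smul_mem _ c h
  refine hleft g (fun f hf => ?_) f hf
  rw [vbracket_antisymm]
  exact Submodule.neg_mem _ (hleft f (fun g hg => hs g hg f hf) g hg)

theorem cos_natCast_mul_mem_span_trigPolyGens (n : ℕ) :
    (fun t => Real.cos (n * t)) ∈ Submodule.span ℝ trigPolyGens := by
  rcases Nat.eq_zero_or_pos n with rfl | hn
  · exact Submodule.subset_span (Or.inl (by simp))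
  · exact Submodule.subset_span (Or.inr ⟨n, hn, Or.inl rfl⟩)

theorem sin_natCast_mul_mem_span_trigPolyGens (n : ℕ) :
    (fun t => Real.sin (n * t)) ∈ Submodule.span ℝ trigPolyGens := by
  rcases Nat.eq_zero_or_pos n with rfl | hn
  · convert Submodule.zero_mem (Submodule.span ℝ trigPolyGens) using 1
    ext t
    simp
  · exact Submodule.subset_span (Or.inr ⟨n, hn, Or.inr rfl⟩)

theorem cos_intCast_mul_mem_span_trigPolyGens (n : ℤ) :
    (fun t => Real.cos (n * t)) ∈ Submodule.span ℝ trigPolyGens := by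
  obtain ⟨m, rfl | rfl⟩ := n.eq_nat_or_neg
  · simpa using cos_natCast_mul_mem_span_trigPolyGens m
  · simpa using cos_natCast_mul_mem_span_trigPolyGens m

theorem sin_intCast_mul_mem_span_trigPolyGens (n : ℤ) :
    (fun t => Real.sin (n * t)) ∈ Submodule.span ℝ trigPolyGens := by
  obtain ⟨m, rfl | rfl⟩ := n.eq_nat_or_neg
  · simpa using sin_natCast_mul_mem_span_trigPolyGens m
  · simpa [Pi.neg_def] using Submodule.neg_mem _ (sin_natCast_mul_mem_span_trigPolyGens m)

theorem eq_cos_or_eq_sin_of_mem_trigPolyGens {f : ℝ → ℝ} (hf : f ∈ trigPolyGens) :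
    ∃ n : ℤ, f = (fun t => Real.cos (n * t)) ∨ f = (fun t => Real.sin (n * t)) := by
  rcases hf with rfl | ⟨n, -, h⟩
  · exact ⟨0, Or.inl (by simp)⟩
  · exact ⟨n, by simpa using h⟩

theorem vbracket_mem_span_trigPolyGens {f g : ℝ → ℝ} (hf : f ∈ Submodule.span ℝ trigPolyGens)
    (hg : g ∈ Submodule.span ℝ trigPolyGens) :
    vbracket f g ∈ Submodule.span ℝ trigPolyGens := by
  refine vbracket_mem_span (fun f hf => ?_) (fun f hf g hg => ?_) hf hg
  · obtain ⟨n, rfl | rfl⟩ := eq_cos_or_eq_sin_of_mem_trigPolyGens hf <;> fun_prop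
  · have hcos (m n : ℤ) := cos_intCast_mul_mem_span_trigPolyGens (m + n)
    have hcos' (m n : ℤ) := cos_intCast_mul_mem_span_trigPolyGens (m - n)
    have hsin (m n : ℤ) := sin_intCast_mul_mem_span_trigPolyGens (m + n)
    have hsin' (m n : ℤ) := sin_intCast_mul_mem_span_trigPolyGens (m - n)
    push_cast at hcos hcos' hsin hsin'
    obtain ⟨m, rfl | rfl⟩ := eq_cos_or_eq_sin_of_mem_trigPolyGens hf <;>
      obtain ⟨n, rfl | rfl⟩ := eq_cos_or_eq_sin_of_mem_trigPolyGens hg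
    · rw [vbracket_cos_cos]
      exact sub_mem (Submodule.smul_mem _ _ (hsin m n)) (Submodule.smul_mem _ _ (hsin' m n))
    · rw [vbracket_antisymm, vbracket_sin_cos]
      exact neg_mem (add_mem (Submodule.smul_mem _ _ (hcos n m))
        (Submodule.smul_mem _ _ (hcos' n m)))
    · rw [vbracket_sin_cos]
      exact add_mem (Submodule.smul_mem _ _ (hcos m n)) (Submodule.smul_mem _ _ (hcos' m n))
    · rw [vbracket_sin_sin]
      exact sub_mem (Submodule.smul_mem _ _ (hsin m n)) (Submodule.smul_mem _ _ (hsin' m n))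

theorem fiveGens_subset_span_trigPolyGens :
    fiveGens ⊆ (Submodule.span ℝ trigPolyGens : Set (ℝ → ℝ)) := by
  rintro f (rfl | rfl | rfl | rfl | rfl)
  · simpa using cos_natCast_mul_mem_span_trigPolyGens 0
  · simpa using cos_natCast_mul_mem_span_trigPolyGens 1
  · simpa using sin_natCast_mul_mem_span_trigPolyGens 1
  · simpa using cos_natCast_mul_mem_span_trigPolyGens 2
  · simpa using sin_natCast_mul_mem_span_trigPolyGens 2

theorem fiveGens_subset_generatedLieAlg : fiveGens ⊆ (generatedLieAlg : Set (ℝ → ℝ)) :=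
  fun _ hf => Submodule.mem_sInf.2 fun _ hS => hS.1 hf

theorem vbracket_mem_generatedLieAlg {f g : ℝ → ℝ} (hf : f ∈ generatedLieAlg)
    (hg : g ∈ generatedLieAlg) : vbracket f g ∈ generatedLieAlg :=
  Submodule.mem_sInf.2 fun S hS =>
    hS.2 f (Submodule.mem_sInf.1 hf S hS) g (Submodule.mem_sInf.1 hg S hS)

/-- For `a ≠ 1`, the frequency `a + 1` is obtained by bracketing the frequencies `a` and `1`. -/
theorem cos_sin_add_one_mem_generatedLieAlg {a : ℝ} (ha : a ≠ 1)
    (hcos : (fun t => Real.cos (a * t)) ∈ generatedLieAlg)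
    (hsin : (fun t => Real.sin (a * t)) ∈ generatedLieAlg)
    (hcos' : (fun t => Real.cos ((a - 1) * t)) ∈ generatedLieAlg)
    (hsin' : (fun t => Real.sin ((a - 1) * t)) ∈ generatedLieAlg) :
    (fun t => Real.cos ((a + 1) * t)) ∈ generatedLieAlg ∧
      (fun t => Real.sin ((a + 1) * t)) ∈ generatedLieAlg := by
  have hcos₁ : (fun t => Real.cos (1 * t)) ∈ generatedLieAlg :=
    fiveGens_subset_generatedLieAlg (by simp [fiveGens])
  have hc := vbracket_mem_generatedLieAlg hsin hcos₁
  have hs := vbracket_mem_generatedLieAlg hcos hcos₁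
  rw [vbracket_sin_cos, Submodule.add_mem_iff_left _ (Submodule.smul_mem _ _ hcos'),
    Submodule.smul_mem_iff _ (div_ne_zero (sub_ne_zero.2 ha) two_ne_zero)] at hc
  rw [vbracket_cos_cos, Submodule.sub_mem_iff_left _ (Submodule.smul_mem _ _ hsin'),
    Submodule.smul_mem_iff _ (div_ne_zero (sub_ne_zero.2 ha.symm) two_ne_zero)] at hs
  exact ⟨hc, hs⟩

theorem cos_sin_natCast_mul_mem_generatedLieAlg {n : ℕ} (hn : 1 ≤ n) :
    (fun t => Real.cos (n * t)) ∈ generatedLieAlg ∧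
      (fun t => Real.sin (n * t)) ∈ generatedLieAlg := by
  induction n using Nat.twoStepInduction with
  | zero => omega
  | one =>
    constructor <;> exact fiveGens_subset_generatedLieAlg (by simp [fiveGens])
  | more k ih ih' =>
    rcases Nat.eq_zero_or_pos k with rfl | hk
    · constructor <;> exact fiveGens_subset_generatedLieAlg (by simp [fiveGens])
    · have h := ih hk
      have h' := ih' (by omega)
      have hne : ((k + 1 : ℕ) : ℝ) ≠ 1 := by
        exact_mod_cast (by omega : k + 1 ≠ 1)
      have hsub : ((k + 1 : ℕ) : ℝ) - 1 = k := by push_cast; ring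
      have hadd : ((k + 2 : ℕ) : ℝ) = ((k + 1 : ℕ) : ℝ) + 1 := by push_cast; ring
      rw [hadd]
      exact cos_sin_add_one_mem_generatedLieAlg hne h'.1 h'.2 (hsub ▸ h.1) (hsub ▸ h.2)

/-- The smallest real linear subspace of smooth functions containing
`1, cos t, sin t, cos 2t, sin 2t` and closed under the bracket
`⟦f,g⟧ = g f′ − g′ f` is exactly the space of all real trigonometric
polynomials; in particular for every `n ≥ 1` the functions `cos (n t)` and
`sin (n t)` lie in the Lie subalgebra generated by those five functions. -/
theorem generatedLieAlg_eq_trigPoly :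
    generatedLieAlg = Submodule.span ℝ trigPolyGens ∧
    ∀ n : ℕ, 1 ≤ n →
      (fun t => Real.cos (n * t)) ∈ generatedLieAlg ∧
      (fun t => Real.sin (n * t)) ∈ generatedLieAlg := by
  refine ⟨le_antisymm (sInf_le ⟨fiveGens_subset_span_trigPolyGens, fun f hf g hg =>
    vbracket_mem_span_trigPolyGens hf hg⟩) (Submodule.span_le.2 ?_),
    fun n hn => cos_sin_natCast_mul_mem_generatedLieAlg hn⟩
  rintro f (rfl | ⟨n, hn, rfl | rfl⟩)
  · exact fiveGens_subset_generatedLieAlg (Or.inl rfl)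
  · exact (cos_sin_natCast_mul_mem_generatedLieAlg hn).1
  · exact (cos_sin_natCast_mul_mem_generatedLieAlg hn).2
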